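/- Let C : f = 0 be a reduced plane curve of degree d in P²(ℂ) and let θ ∈ D_0(f) be a nonzero derivation of degree r with 2r ≤ d − 1, such that the eigenscheme Γ_θ is 0-dimensional. Then: (1) r = mdr(f); (2) C is a plus-one generated curve if and only if the ideal quotient K_{θ,f} = I_θ : (f) is a proper ideal of S whose degree one component (K_{θ,f})₁ is nonzero. If (2) holds, then K_{θ,f} is generated by two elements, a linear form ℓ ∈ S₁ and a homogeneous polynomial h ∈ S_e with e ≥ 1, and the exponents of C are (r, d−r, d−r−1+e); in particular C is nearly free if and only if e = 1, and C is a minimal plus-one generated (MPOG) curve if and only if e = 2. -/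

import Mathlib

open MvPolynomial

noncomputable section

/-- `S = ℂ[x,y,z]`, with `x = X 0`, `y = X 1`, `z = X 2`. -/
abbrev S3 := MvPolynomial (Fin 3) ℂ

/-- The graded `S`-module `D_0(f)` of Jacobian syzygies of `f`. -/
def jacSyz (f : S3) : Submodule S3 (Fin 3 → S3) where
  carrier := {v | v 0 * pderiv 0 f + v 1 * pderiv 1 f + v 2 * pderiv 2 f = 0}
  add_mem' := by
    intro a b ha hb
    simp only [Set.mem_setOf_eq, Pi.add_apply] at *
    linear_combination ha + hb
  zero_mem' := by simp
  smul_mem' := by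
    intro c v hv
    simp only [Set.mem_setOf_eq, Pi.smul_apply, smul_eq_mul] at *
    linear_combination c * hv

/-- `v` is a minimal system of `m` homogeneous generators of `D_0(f)`, the generator
`v j` being a syzygy of degree `dd j`, and `dd` nondecreasing: this says that
`C : f = 0` is an `m`-syzygy curve with exponents `dd`. -/
structure IsMinGenSyz (f : S3) (m : ℕ) (dd : Fin m → ℕ) (v : Fin m → (Fin 3 → S3)) : Prop where
  mem : ∀ j, v j ∈ jacSyz f
  hom : ∀ j i, ((v j) i).IsHomogeneous (dd j)
  ne_zero : ∀ j, v j ≠ 0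
  span_eq : Submodule.span S3 (Set.range v) = jacSyz f
  minimal : ∀ j, v j ∉ Submodule.span S3 (v '' {j' | j' ≠ j})
  mono : Monotone dd

/-- `C : f = 0` is free with exponents `(d1, d2)`. -/
def IsFreeWith (f : S3) (d1 d2 : ℕ) : Prop := ∃ v, IsMinGenSyz f 2 ![d1, d2] v

/-- `C : f = 0` is a free curve (a 2-syzygy curve). -/
def IsFreeCurve (f : S3) : Prop := ∃ d1 d2, IsFreeWith f d1 d2

/-- `C : f = 0` of degree `d` is nearly free with exponents `(d1, d2)`:
a 3-syzygy curve with exponents `(d1, d2, d2)` and `d1 + d2 = d`. -/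
def IsNearlyFreeWith (f : S3) (d d1 d2 : ℕ) : Prop :=
  d1 + d2 = d ∧ ∃ v, IsMinGenSyz f 3 ![d1, d2, d2] v

/-- `C : f = 0` of degree `d` is a nearly free curve. -/
def IsNearlyFree (f : S3) (d : ℕ) : Prop := ∃ d1 d2, IsNearlyFreeWith f d d1 d2

/-- `C : f = 0` of degree `d` is plus-one generated with exponents `(d1, d2, d3)`:
a 3-syzygy curve with `d1 + d2 = d`. -/
def IsPOGWith (f : S3) (d d1 d2 d3 : ℕ) : Prop :=
  d1 + d2 = d ∧ ∃ v, IsMinGenSyz f 3 ![d1, d2, d3] v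

/-- `C : f = 0` of degree `d` is a plus-one generated curve. -/
def IsPOG (f : S3) (d : ℕ) : Prop := ∃ d1 d2 d3, IsPOGWith f d d1 d2 d3

/-- `C : f = 0` of degree `d` is minimal plus-one generated (MPOG),
with exponents `(d1, d2, d2 + 1)`. -/
def IsMPOGWith (f : S3) (d d1 d2 : ℕ) : Prop := IsPOGWith f d d1 d2 (d2 + 1)

/-- `C : f = 0` of degree `d` is an MPOG-curve. -/
def IsMPOG (f : S3) (d : ℕ) : Prop := ∃ d1 d2, IsMPOGWith f d d1 d2

/-- `r = mdr(f)`: the minimal degree of a nonzero (homogeneous) Jacobian relation for `f`. -/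
def IsMDR (f : S3) (r : ℕ) : Prop :=
  (∃ v ∈ jacSyz f, v ≠ 0 ∧ ∀ i, (v i).IsHomogeneous r) ∧
  ∀ m, m < r → ∀ v ∈ jacSyz f, (∀ i, (v i).IsHomogeneous m) → v = 0

/-- The Jacobian ideal `J_f` of `f`. -/
def jacobianIdeal (f : S3) : Ideal S3 := Ideal.span {pderiv 0 f, pderiv 1 f, pderiv 2 f}

/-- The dimension of the degree `k` graded piece of the Milnor algebra `M(f) = S/J_f`. -/
def milnorDim (f : S3) (k : ℕ) : ℕ :=
  Module.finrank ℂ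
    (↥(homogeneousSubmodule (Fin 3) ℂ k) ⧸
      (Submodule.comap (homogeneousSubmodule (Fin 3) ℂ k).subtype
        (Submodule.restrictScalars ℂ (jacobianIdeal f))))

/-- `τ` is the total Tjurina number of the reduced curve `C : f = 0`, i.e. the degree of the
Jacobian ideal `J_f`: for all large `k` one has `dim M(f)_k = τ`. -/
def IsTjurina (f : S3) (τ : ℕ) : Prop := ∀ᶠ k in Filter.atTop, milnorDim f k = τ

/-- `C : f = 0` is a maximal Tjurina curve of type `(d, r)`. -/
def IsMaxTjurina (f : S3) (d r : ℕ) : Prop :=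
  IsMDR f r ∧ d ≤ 2 * r ∧
  ∃ τ : ℕ, IsTjurina f τ ∧
    (τ : ℤ) = ((d : ℤ) - 1) ^ 2 - r * ((d : ℤ) - r - 1) - (Nat.choose (2 * r + 2 - d) 2 : ℤ)

/-- `f` is a product of `d` linear forms all vanishing at a common point, i.e.
`C : f = 0` is the union of `d` lines passing through one point. -/
def IsUnionOfConcurrentLines (f : S3) (d : ℕ) : Prop :=
  ∃ (c : ℂ) (L : Fin d → Fin 3 → ℂ) (v : Fin 3 → ℂ), v ≠ 0 ∧
    f = C c * ∏ j, (∑ i, C (L j i) * X i) ∧ ∀ j, (∑ i, L j i * v i) = 0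

/-- The ideal `I_θ` generated by the 2×2 minors of the matrix with rows `(x,y,z)` and
`(a,b,c)`, defining the eigenscheme `Γ_θ` of the derivation `θ = a ∂_x + b ∂_y + c ∂_z`. -/
def eigenIdeal (a b c : S3) : Ideal S3 :=
  Ideal.span {X 1 * c - X 2 * b, X 2 * a - X 0 * c, X 0 * b - X 1 * a}

/-- The projective plane `ℙ²(ℂ)`. -/
abbrev Pt := Projectivization ℂ (Fin 3 → ℂ)

/-- The eigenscheme `Γ_θ` of `θ = a ∂_x + b ∂_y + c ∂_z` is 0-dimensional:
its set of points in `ℙ²` is finite. -/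
def EigenSchemeFinite (a b c : S3) : Prop :=
  {p : Pt | eval p.rep (X 1 * c - X 2 * b) = 0 ∧ eval p.rep (X 2 * a - X 0 * c) = 0 ∧
      eval p.rep (X 0 * b - X 1 * a) = 0}.Finite

namespace MvPolynomial

section Homogeneous

attribute [local instance] MvPolynomial.gradedAlgebra

variable {σ R : Type*} [CommRing R]

lemma homogeneousComponent_mul_of_le {q : MvPolynomial σ R} {k n : ℕ}
    (hq : q.IsHomogeneous k) (hkn : k ≤ n) (p : MvPolynomial σ R) :
    homogeneousComponent n (p * q) = homogeneousComponent (n - k) p * q := by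
  simp only [← decomposition.decompose'_apply]
  exact DirectSum.coe_decompose_mul_of_right_mem_of_le (homogeneousSubmodule σ R)
    (a := p) (b := q) hq hkn

lemma homogeneousComponent_mul_of_lt {q : MvPolynomial σ R} {k n : ℕ}
    (hq : q.IsHomogeneous k) (hkn : n < k) (p : MvPolynomial σ R) :
    homogeneousComponent n (p * q) = 0 := by
  rw [← decomposition.decompose'_apply]
  exact DirectSum.coe_decompose_mul_of_right_mem_of_not_le (homogeneousSubmodule σ R)
    (a := p) (b := q) hq (not_le.mpr hkn)

lemma coeff_aeval_C_X_mul_X (p : MvPolynomial σ R) (n : ℕ) :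
    (aeval (fun i => Polynomial.C (X i) * Polynomial.X) p :
      Polynomial (MvPolynomial σ R)).coeff n = homogeneousComponent n p := by
  induction p using MvPolynomial.induction_on' with
  | monomial e r =>
    have key : (aeval (fun i => Polynomial.C (X i) * Polynomial.X) (monomial e r) :
        Polynomial (MvPolynomial σ R)) = Polynomial.C (monomial e r) * Polynomial.X ^ e.degree := by
      rw [aeval_monomial]
      rw [monomial_eq, Polynomial.C_mul, mul_assoc, Finsupp.degree_apply]
      simp only [Finsupp.prod, mul_pow, Finset.prod_mul_distrib, map_prod, map_pow,
        Finset.prod_pow_eq_pow_sum]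
      rfl
    rw [key, Polynomial.coeff_C_mul_X_pow,
      homogeneousComponent_of_mem (isHomogeneous_monomial r rfl)]
  | add p q hp hq => simp [hp, hq]

lemma aeval_C_X_mul_X_injective : Function.Injective
    (aeval (fun i => Polynomial.C (X i) * Polynomial.X) :
      MvPolynomial σ R →ₐ[R] Polynomial (MvPolynomial σ R)) := by
  intro p q h
  have hc (n : ℕ) : homogeneousComponent n p = homogeneousComponent n q := by
    rw [← coeff_aeval_C_X_mul_X, h, coeff_aeval_C_X_mul_X]
  ext e
  simpa [coeff_homogeneousComponent] using congr(coeff e $(hc e.degree))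

/-- A factor of a nonzero homogeneous polynomial over a domain is homogeneous. -/
lemma IsHomogeneous.exists_of_dvd [IsDomain R] {p F : MvPolynomial σ R} {N : ℕ}
    (hF : F.IsHomogeneous N) (hF0 : F ≠ 0) (h : p ∣ F) : ∃ n, p.IsHomogeneous n := by
  obtain ⟨q, rfl⟩ := h
  set T : MvPolynomial σ R →ₐ[R] Polynomial (MvPolynomial σ R) :=
    MvPolynomial.aeval (fun i => Polynomial.C (X i) * Polynomial.X)
  have hp0 : T p ≠ 0 := (map_ne_zero_iff T aeval_C_X_mul_X_injective).2 (left_ne_zero_of_mul hF0)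
  have hq0 : T q ≠ 0 := (map_ne_zero_iff T aeval_C_X_mul_X_injective).2 (right_ne_zero_of_mul hF0)
  have hprod : T p * T q = Polynomial.C (p * q) * Polynomial.X ^ N := by
    rw [← map_mul]
    ext1 n
    rw [coeff_aeval_C_X_mul_X, Polynomial.coeff_C_mul_X_pow, homogeneousComponent_of_mem hF]
  have h1 := Polynomial.natDegree_mul hp0 hq0
  have h2 := Polynomial.natTrailingDegree_mul hp0 hq0
  rw [hprod, Polynomial.natDegree_C_mul_X_pow _ _ hF0] at h1
  rw [hprod, Polynomial.C_mul_X_pow_eq_monomial, Polynomial.natTrailingDegree_monomial hF0] at h2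
  have h3 := (T p).natTrailingDegree_le_natDegree
  have h4 := (T q).natTrailingDegree_le_natDegree
  refine ⟨(T p).natDegree, ?_⟩
  suffices p = homogeneousComponent (T p).natDegree p by
    have hcomp := homogeneousComponent_isHomogeneous (T p).natDegree p
    rwa [← this] at hcomp
  apply aeval_C_X_mul_X_injective
  ext1 n
  rw [coeff_aeval_C_X_mul_X, coeff_aeval_C_X_mul_X,
    homogeneousComponent_of_mem (homogeneousComponent_isHomogeneous _ p)]
  split_ifs with hn
  · rw [hn]
  · rw [← coeff_aeval_C_X_mul_X]
    rcases lt_or_gt_of_ne hn with hlt | hlt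
    · exact Polynomial.coeff_eq_zero_of_lt_natTrailingDegree
        (lt_of_lt_of_le hlt (by change (T p).natDegree ≤ (T p).natTrailingDegree; omega))
    · exact Polynomial.coeff_eq_zero_of_natDegree_lt hlt

/-- The cofactor of a nonzero homogeneous polynomial in a homogeneous product. -/
lemma IsHomogeneous.of_mul_right [IsDomain R] {p q : MvPolynomial σ R} {k n : ℕ}
    (hq : q.IsHomogeneous k) (hq0 : q ≠ 0) (h : (p * q).IsHomogeneous (n + k)) :
    p.IsHomogeneous n := by
  have hself := homogeneousComponent_eq_self h
  rw [homogeneousComponent_mul_of_le hq (by omega), Nat.add_sub_cancel] at hself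
  rw [← mul_right_cancel₀ hq0 hself]
  exact homogeneousComponent_isHomogeneous _ _

lemma IsHomogeneous.le_of_mul [IsDomain R] {p q : MvPolynomial σ R} {k m : ℕ}
    (hq : q.IsHomogeneous k) (h0 : p * q ≠ 0) (h : (p * q).IsHomogeneous m) : k ≤ m := by
  by_contra! hlt
  apply h0
  rw [← homogeneousComponent_eq_self h, homogeneousComponent_mul_of_lt hq hlt]

lemma IsHomogeneous.eval_smul {p : MvPolynomial σ R} {n : ℕ} (hp : p.IsHomogeneous n)
    (t : R) (v : σ → R) : eval (t • v) p = t ^ n * eval v p := by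
  rw [eval_eq, eval_eq, Finset.mul_sum]
  refine Finset.sum_congr rfl fun e he => ?_
  have hd : e.degree = n := by
    by_contra hne
    exact (mem_support_iff.mp he) (hp.coeff_eq_zero hne)
  simp only [Pi.smul_apply, smul_eq_mul, mul_pow, Finset.prod_mul_distrib,
    Finset.prod_pow_eq_pow_sum]
  rw [← hd, Finsupp.degree_apply]
  ring

end Homogeneous

lemma IsHomogeneous.ne_zero_of_not_isUnit {σ K : Type*} [Field K] {p : MvPolynomial σ K} {n : ℕ}
    (hp : p.IsHomogeneous n) (hp0 : p ≠ 0) (hunit : ¬ IsUnit p) : n ≠ 0 := by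
  rintro rfl
  obtain ⟨c, rfl⟩ : ∃ c, p = C c :=
    ⟨_, totalDegree_eq_zero_iff_eq_C.mp ((totalDegree_zero_iff_isHomogeneous _).mpr hp)⟩
  exact hunit ((IsUnit.mk0 c (by rintro rfl; exact hp0 C_0)).map C)

lemma polynomial_eval_aeval {σ K : Type*} [Field K] (g : σ → Polynomial K) (t : K)
    (p : MvPolynomial σ K) : (aeval g p).eval t = eval (fun i => (g i).eval t) p := by
  induction p using MvPolynomial.induction_on with
  | C r => simp
  | add p q hp hq => simp [hp, hq]
  | mul_X p i hp => simp [hp]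

/-- A form of positive degree vanishes somewhere on every affine line whose direction is not one
of its zeros. -/
lemma IsHomogeneous.exists_eval_add_smul_eq_zero {σ K : Type*} [Field K] [IsAlgClosed K]
    {p : MvPolynomial σ K} {n : ℕ} (hp : p.IsHomogeneous n) (hn : n ≠ 0) (A Q : σ → K)
    (hQ : eval Q p ≠ 0) : ∃ t : K, eval (A + t • Q) p = 0 := by
  set P : Polynomial K :=
    MvPolynomial.aeval (fun i => Polynomial.C (A i) + Polynomial.C (Q i) * Polynomial.X) p with hP
  have hPe (t : K) : P.eval t = eval (A + t • Q) p := by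
    rw [hP, polynomial_eval_aeval]
    congr 2
    ext i
    simp [mul_comm t]
  set P' : Polynomial K :=
    MvPolynomial.aeval (fun i => Polynomial.C (A i) * Polynomial.X + Polynomial.C (Q i)) p with hP'
  have hPe' (t : K) : P'.eval t = eval (t • A + Q) p := by
    rw [hP', polynomial_eval_aeval]
    congr 2
    ext i
    simp [mul_comm t]
  by_contra! hno
  have hdeg : P.degree = 0 := by
    by_contra hd
    obtain ⟨t, ht⟩ := IsAlgClosed.exists_root P hd
    exact hno t (by rw [← hPe]; exact ht)
  obtain ⟨c, hc⟩ : ∃ c, P = Polynomial.C c := ⟨_, Polynomial.eq_C_of_degree_eq_zero hdeg⟩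
  have hPP : P' = Polynomial.C c * Polynomial.X ^ n := by
    refine Polynomial.eq_of_infinite_eval_eq _ _
      (((Set.finite_singleton (0 : K)).infinite_compl).mono fun s hs => ?_)
    have hs0 : s ≠ 0 := hs
    have : s • A + Q = s • (A + s⁻¹ • Q) := by
      rw [smul_add, smul_smul, mul_inv_cancel₀ hs0, one_smul]
    simp only [Set.mem_ofPred_eq]
    rw [hPe', this, hp.eval_smul, ← hPe, hc]
    simp [mul_comm c]
  apply hQ
  have := hPe' 0
  rw [zero_smul, zero_add] at this
  rw [← this, hPP]
  simp [hn]

/-- A plane curve given by a form of positive degree has infinitely many points. -/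
lemma IsHomogeneous.infinite_projective_zeros {K : Type*} [Field K] [IsAlgClosed K]
    {p : MvPolynomial (Fin 3) K} {n : ℕ} (hp : p.IsHomogeneous n) (hn : n ≠ 0) (hp0 : p ≠ 0) :
    {P : Projectivization K (Fin 3 → K) | eval P.rep p = 0}.Infinite := by
  have : Infinite K := IsAlgClosed.instInfinite
  obtain ⟨Q, hQ⟩ : ∃ Q, eval Q p ≠ 0 := by
    by_contra! h
    exact hp0 (MvPolynomial.funext fun Q => by simpa using h Q)
  obtain ⟨i, hi⟩ : ∃ i, Q i ≠ 0 := by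
    by_contra! h
    apply hQ
    have hQ0 : Q = (0 : K) • Q := by ext i; simp [h i]
    rw [hQ0, hp.eval_smul]
    simp [hn]
  obtain ⟨j, k, hji, hki, hjk⟩ : ∃ j k : Fin 3, j ≠ i ∧ k ≠ i ∧ j ≠ k := by
    clear hi; revert i; decide
  choose t ht using fun s : K =>
    hp.exists_eval_add_smul_eq_zero hn (Pi.single j 1 + s • Pi.single k 1) Q hQ
  set V : K → Fin 3 → K := fun s => Pi.single j 1 + s • Pi.single k 1 + t s • Q with hV
  have hVi (s) : V s i = t s * Q i := by simp [hV, hji.symm, hki.symm]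
  have hVj (s) : V s j = 1 + t s * Q j := by simp [hV, hjk]
  have hVk (s) : V s k = s + t s * Q k := by simp [hV, hjk.symm]
  have hV0 (s) : V s ≠ 0 := by
    intro h
    have h1 := congrFun h i
    have h2 := congrFun h j
    rw [hVi] at h1
    rw [hVj] at h2
    simp [hi] at h1
    simp [h1] at h2
  refine Set.infinite_of_injective_forall_mem
    (f := fun s => Projectivization.mk K (V s) (hV0 s)) ?_ ?_
  · intro s s' hss
    obtain ⟨a, ha⟩ := (Projectivization.mk_eq_mk_iff' K _ _ _ _).1 hss
    have h1 := congrFun ha i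
    have h2 := congrFun ha j
    have h3 := congrFun ha k
    simp only [Pi.smul_apply, smul_eq_mul, hVi, hVj, hVk] at h1 h2 h3
    have h4 : a * t s' = t s := mul_right_cancel₀ hi (by linear_combination h1)
    have h5 : a = 1 := by linear_combination h2 - Q j * h4
    subst h5
    linear_combination -h3 + Q k * h4
  · intro s
    obtain ⟨a, ha⟩ := Projectivization.exists_smul_eq_mk_rep K (V s) (hV0 s)
    simp only [Set.mem_ofPred_eq]
    rw [← ha, Units.smul_def, hp.eval_smul]
    rw [show eval (V s) p = 0 from ht s, mul_zero]

end MvPolynomial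

/-- The coordinates of a vector have no common nonunit divisor. -/
def IsPrimitiveVec {R : Type*} [CommRing R] (u : Fin 3 → R) : Prop :=
  ∀ p, (∀ i, p ∣ u i) → IsUnit p

lemma IsPrimitiveVec.ne_zero {R : Type*} [CommRing R] [IsDomain R] {u : Fin 3 → R}
    (hu : IsPrimitiveVec u) : u ≠ 0 := by
  rintro rfl
  exact not_isUnit_zero (hu 0 fun i => by simp)

lemma IsPrimitiveVec.of_irreducible {R : Type*} [CommRing R] [IsDomain R]
    [UniqueFactorizationMonoid R] {u : Fin 3 → R} (hu0 : u ≠ 0)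
    (hu : ∀ p, Irreducible p → ¬ ∀ i, p ∣ u i) : IsPrimitiveVec u := by
  intro p hp
  by_contra hunit
  have hp0 : p ≠ 0 := by
    rintro rfl
    exact hu0 (funext fun i => by simpa using hp i)
  obtain ⟨q, hq, hqp⟩ := WfDvdMonoid.exists_irreducible_factor hunit hp0
  exact hu q hq fun i => hqp.trans (hp i)

open Matrix in
/-- A vector parallel to a primitive vector is a multiple of it. -/
lemma IsPrimitiveVec.exists_eq_smul {R : Type*} [CommRing R] [IsDomain R]
    [UniqueFactorizationMonoid R] {u w : Fin 3 → R} (hu : IsPrimitiveVec u)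
    (h : u ⨯₃ w = 0) : ∃ μ : R, w = μ • u := by
  have hcomm : ∀ i j, u i * w j = u j * w i := by
    have h0 := congrFun h 0
    have h1 := congrFun h 1
    have h2 := congrFun h 2
    simp only [cross_apply, Matrix.cons_val, Pi.zero_apply] at h0 h1 h2
    intro i j
    fin_cases i <;> fin_cases j <;> simp only [Fin.zero_eta, Fin.mk_one, Fin.reduceFinMk] <;> grind
  obtain ⟨i, hi⟩ := Function.ne_iff.mp hu.ne_zero
  have : Nonempty (NormalizedGCDMonoid R) := inferInstance
  obtain ⟨_⟩ := this
  have hunit : IsUnit (Finset.univ.gcd u) := hu _ fun i => Finset.gcd_dvd (Finset.mem_univ i)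
  have hdvd : u i ∣ Finset.univ.gcd fun j => u j * w i :=
    Finset.dvd_gcd fun j _ => ⟨w j, (hcomm i j).symm⟩
  obtain ⟨μ, hμ⟩ : u i ∣ w i := by
    have := hdvd.trans (Finset.gcd_mul_right' Finset.univ u (w i)).dvd
    exact hunit.dvd_mul_left.mp this
  refine ⟨μ, funext fun j => mul_left_cancel₀ hi ?_⟩
  rw [hcomm, hμ]
  simp only [Pi.smul_apply, smul_eq_mul]
  ring

/-- In a factorial domain, a nonzero ideal which is closed under cancelling relatively prime
cofactors is principal. -/
lemma Ideal.exists_eq_span_singleton_of_isRelPrime {R : Type*} [CommRing R] [IsDomain R]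
    [UniqueFactorizationMonoid R] {J : Ideal R} (hJ : J ≠ ⊥)
    (hsat : ∀ g p q, IsRelPrime p q → p ≠ 0 → g * p ∈ J → g * q ∈ J → g ∈ J) :
    ∃ k, k ≠ 0 ∧ J = Ideal.span {k} := by
  obtain ⟨x, hxJ, hx0⟩ := Submodule.exists_mem_ne_zero_of_ne_bot hJ
  obtain ⟨k, ⟨hkJ, hk0⟩, hmin⟩ :=
    (wellFounded_dvdNotUnit (α := R)).has_min {y | y ∈ J ∧ y ≠ 0} ⟨x, hxJ, hx0⟩
  refine ⟨k, hk0, le_antisymm (fun y hy => ?_) ?_⟩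
  · obtain ⟨p, q, g, hpq, hgp, hgq⟩ := UniqueFactorizationMonoid.exists_reduced_factors k hk0 y
    have hg0 : g ≠ 0 := by rintro rfl; exact hk0 (by simpa using hgp.symm)
    have hp0 : p ≠ 0 := by rintro rfl; exact hk0 (by simpa using hgp.symm)
    have hg : g ∈ J := hsat g p q hpq hp0 (hgp ▸ hkJ) (hgq ▸ hy)
    have hp : IsUnit p := by
      by_contra hp
      exact hmin g ⟨hg, hg0⟩ ⟨hg0, p, hp, hgp.symm⟩
    rw [Ideal.mem_span_singleton, ← hgp, ← hgq]
    exact (hp.mul_right_dvd).mpr (dvd_mul_right g q)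
  · rwa [Ideal.span_singleton_le_iff_mem]

namespace MvPolynomial

/-- Elimination of one variable along a nonzero linear form, with a graded section. -/
lemma exists_retraction_of_isHomogeneous_one {σ K : Type*} [Fintype σ] [Field K]
    {ℓ : MvPolynomial σ K} (hℓ : ℓ.IsHomogeneous 1) (hℓ0 : ℓ ≠ 0) :
    ∃ (i : σ) (π : MvPolynomial σ K →ₐ[K] MvPolynomial {j // j ≠ i} K),
      (∀ y, π (rename Subtype.val y) = y) ∧ ∀ x, π x = 0 ↔ ℓ ∣ x := by
  classical
  rw [← mem_homogeneousSubmodule, homogeneousSubmodule_one_eq_span_X,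
    Submodule.mem_span_range_iff_exists_fun] at hℓ
  obtain ⟨c, hc⟩ := hℓ
  obtain ⟨i, hi⟩ : ∃ i, c i ≠ 0 := by
    by_contra! h
    exact hℓ0 (by rw [← hc]; simp [h])
  set L : MvPolynomial {j // j ≠ i} K := ∑ j, c j.1 • X j with hL
  set π : MvPolynomial σ K →ₐ[K] MvPolynomial {j // j ≠ i} K :=
    aeval fun j => if h : j ≠ i then X ⟨j, h⟩ else -((c i)⁻¹ • L) with hπ
  have hsplit : ℓ = c i • X i + rename Subtype.val L := by
    rw [← hc, ← Finset.add_sum_erase _ _ (Finset.mem_univ i), hL, map_sum]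
    congr 1
    simp only [map_smul, rename_X]
    rw [Finset.sum_subtype (p := fun j => j ≠ i) _ (by simp)]
  have hsec (y) : π (rename Subtype.val y) = y := by
    rw [hπ, aeval_rename]
    conv_rhs => rw [← aeval_X_left_apply y]
    congr 2
    ext1 j
    simp [j.2]
  refine ⟨i, π, hsec, ?_⟩
  have hπℓ : π ℓ = 0 := by
    rw [hsplit, map_add, hsec, map_smul, hπ, aeval_X]
    simp [smul_smul, hi]
  have hmod (x) : ℓ ∣ x - rename Subtype.val (π x) := by
    induction x using MvPolynomial.induction_on with
    | C r => simp [hπ]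
    | add p q hp hq =>
      rw [map_add, map_add, add_sub_add_comm]
      exact dvd_add hp hq
    | mul_X p j hp =>
      have hX : ℓ ∣ X j - rename Subtype.val (π (X j)) := by
        by_cases hj : j = i
        · subst hj
          refine ⟨C (c j)⁻¹, ?_⟩
          rw [hsplit, hπ, aeval_X]
          simp only [ne_eq, not_true_eq_false, dite_false, map_neg, smul_eq_C_mul, map_mul, rename_C]
          have : (C (c j) * C (c j)⁻¹ : MvPolynomial σ K) = 1 := by
            rw [← C_mul, mul_inv_cancel₀ hi, C_1]
          linear_combination -X j * this
        · rw [hπ, aeval_X]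
          simp [hj]
      rw [map_mul, map_mul]
      have := dvd_add (dvd_mul_of_dvd_left hp (X j))
        (dvd_mul_of_dvd_right hX (rename Subtype.val (π p)))
      convert this using 1
      ring
  intro x
  refine ⟨fun h => by simpa [h] using hmod x, ?_⟩
  rintro ⟨y, rfl⟩
  rw [map_mul, hπℓ, zero_mul]

end MvPolynomial

/-- The gradient of `f`. -/
def jacGrad (f : S3) : Fin 3 → S3 := fun i => pderiv i f

lemma mem_jacSyz_iff {f : S3} {v : Fin 3 → S3} :
    v ∈ jacSyz f ↔ v 0 * pderiv 0 f + v 1 * pderiv 1 f + v 2 * pderiv 2 f = 0 := Iff.rfl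

lemma jacGrad_euler {f : S3} {d : ℕ} (hf : f.IsHomogeneous d) :
    X 0 * pderiv 0 f + X 1 * pderiv 1 f + X 2 * pderiv 2 f = C (d : ℂ) * f := by
  have := hf.sum_X_mul_pderiv
  rw [Fin.sum_univ_three] at this
  rw [this]
  simp

lemma isPrimitiveVec_jacGrad {f : S3} {d : ℕ} (hf : f.IsHomogeneous d) (hd : d ≠ 0)
    (hsq : Squarefree f) : IsPrimitiveVec (jacGrad f) := by
  have hf0 : f ≠ 0 := hsq.ne_zero
  have hdC : IsUnit (C (d : ℂ) : S3) := (IsUnit.mk0 (d : ℂ) (by exact_mod_cast hd)).map C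
  have hE := jacGrad_euler hf
  refine IsPrimitiveVec.of_irreducible ?_ ?_
  · intro h0
    have h (i) : pderiv i f = 0 := congrFun h0 i
    rw [h, h, h] at hE
    simp [hf0, hd] at hE
  · intro q hq hdvd
    have hprime : Prime q := hq.prime
    have hqf : q ∣ f := by
      rw [← hdC.dvd_mul_left, ← hE]
      exact dvd_add (dvd_add (Dvd.dvd.mul_left (hdvd 0) _) (Dvd.dvd.mul_left (hdvd 1) _))
        (Dvd.dvd.mul_left (hdvd 2) _)
    obtain ⟨n, hn⟩ := hf.exists_of_dvd hf0 hqf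
    have hn0 : n ≠ 0 := hn.ne_zero_of_not_isUnit hq.ne_zero hq.not_isUnit
    obtain ⟨g, rfl⟩ := hqf
    have hqg : ¬ q ∣ g := fun h => hq.not_isUnit (hsq q (mul_dvd_mul_left q h))
    have hder (i) : pderiv i q = 0 := by
      have h1 : q ∣ pderiv i (q * g) := hdvd i
      rw [Derivation.leibniz, smul_eq_mul, smul_eq_mul, dvd_add_right (dvd_mul_right _ _)] at h1
      obtain ⟨y, hy⟩ := (hprime.dvd_or_dvd h1).resolve_left hqg
      by_contra hne
      have := hn.le_of_mul (p := y) (m := n - 1) (by rwa [mul_comm, ← hy])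
        (by rw [mul_comm, ← hy]; exact hn.pderiv)
      omega
    have hEq := jacGrad_euler hn
    rw [hder, hder, hder] at hEq
    simp [hn0, hq.ne_zero] at hEq

open Matrix

lemma X_cross_apply (θ : Fin 3 → S3) : (X : Fin 3 → S3) ⨯₃ θ =
    ![X 1 * θ 2 - X 2 * θ 1, X 2 * θ 0 - X 0 * θ 2, X 0 * θ 1 - X 1 * θ 0] := cross_apply _ _

lemma isHomogeneous_X_cross {θ : Fin 3 → S3} {r : ℕ} (hθ : ∀ i, (θ i).IsHomogeneous r) (i : Fin 3) :
    (((X : Fin 3 → S3) ⨯₃ θ) i).IsHomogeneous (1 + r) := by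
  have h (j k) : (X j * θ k : S3).IsHomogeneous (1 + r) := (isHomogeneous_X ℂ j).mul (hθ k)
  rw [X_cross_apply]
  fin_cases i <;> exact (h _ _).sub (h _ _)

lemma isPrimitiveVec_X_cross {θ : Fin 3 → S3} {r : ℕ} (hθ : ∀ i, (θ i).IsHomogeneous r)
    (hΓ : EigenSchemeFinite (θ 0) (θ 1) (θ 2)) : IsPrimitiveVec ((X : Fin 3 → S3) ⨯₃ θ) := by
  have hsub (p : S3) (hp : ∀ i, p ∣ ((X : Fin 3 → S3) ⨯₃ θ) i) :
      {P : Pt | eval P.rep p = 0}.Finite := by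
    refine hΓ.subset fun P hP => ?_
    have hz (i) : eval P.rep (((X : Fin 3 → S3) ⨯₃ θ) i) = 0 := by
      obtain ⟨y, hy⟩ := hp i
      rw [hy, map_mul, show eval P.rep p = 0 from hP, zero_mul]
    rw [X_cross_apply] at hz
    exact ⟨hz 0, hz 1, hz 2⟩
  have h0 : (X : Fin 3 → S3) ⨯₃ θ ≠ 0 := by
    intro h0
    exact (isHomogeneous_X ℂ 0).infinite_projective_zeros one_ne_zero (X_ne_zero 0)
      (hsub (X 0) fun i => by simp [h0])
  refine IsPrimitiveVec.of_irreducible h0 fun p hp hdvd => ?_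
  obtain ⟨i, hi⟩ := Function.ne_iff.mp h0
  obtain ⟨n, hn⟩ := (isHomogeneous_X_cross hθ i).exists_of_dvd hi (hdvd i)
  have hn0 : n ≠ 0 := hn.ne_zero_of_not_isUnit hp.ne_zero hp.not_isUnit
  exact hn.infinite_projective_zeros hn0 hp.ne_zero (hsub p hdvd)

/-- The standing data: a derivation `θ` of degree `r` with `2r < d` killing the form `f` of
degree `d`, where the gradient of `f` and the equations of the eigenscheme of `θ` have no common
factor. -/
structure IsEigenData (f : S3) (d r : ℕ) (θ : Fin 3 → S3) : Prop where
  hom : f.IsHomogeneous d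
  hom_theta : ∀ i, (θ i).IsHomogeneous r
  syz : θ ∈ jacSyz f
  two_mul_lt : 2 * r + 1 ≤ d
  grad : IsPrimitiveVec (jacGrad f)
  eigen : IsPrimitiveVec ((X : Fin 3 → S3) ⨯₃ θ)

/-- The ideal quotient `I_θ : (f)`. -/
def eigenQuotient (f : S3) (θ : Fin 3 → S3) : Ideal S3 :=
  Submodule.colon (eigenIdeal (θ 0) (θ 1) (θ 2)) (Ideal.span {f})

/-- The homogeneous component of degree `n` of a vector of polynomials. -/
def vecComponent (n : ℕ) (v : Fin 3 → S3) : Fin 3 → S3 := fun i => homogeneousComponent n (v i)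

lemma vecComponent_add (n : ℕ) (v w : Fin 3 → S3) :
    vecComponent n (v + w) = vecComponent n v + vecComponent n w := by
  ext1 i; simp [vecComponent]

lemma vecComponent_eq_self {n : ℕ} {v : Fin 3 → S3} (hv : ∀ i, (v i).IsHomogeneous n) :
    vecComponent n v = v := funext fun i => homogeneousComponent_eq_self (hv i)

lemma vecComponent_smul_of_lt {m n : ℕ} {v : Fin 3 → S3} (hv : ∀ i, (v i).IsHomogeneous m)
    (h : n < m) (c : S3) : vecComponent n (c • v) = 0 :=
  funext fun i => homogeneousComponent_mul_of_lt (hv i) h c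

lemma vecComponent_smul_self {n : ℕ} {v : Fin 3 → S3} (hv : ∀ i, (v i).IsHomogeneous n)
    (c : S3) : vecComponent n (c • v) = (C (coeff 0 c) : S3) • v := by
  ext1 i
  have := homogeneousComponent_mul_of_le (hv i) le_rfl c
  rw [Nat.sub_self, homogeneousComponent_zero] at this
  exact this

namespace IsEigenData

variable {f : S3} {d r : ℕ} {θ : Fin 3 → S3}

lemma primitive_theta (D : IsEigenData f d r θ) : IsPrimitiveVec θ := by
  intro p hp
  refine D.eigen p fun i => ?_
  rw [X_cross_apply]
  fin_cases i <;> exact dvd_sub (Dvd.dvd.mul_left (hp _) _) (Dvd.dvd.mul_left (hp _) _)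

lemma exists_eq_smul (D : IsEigenData f d r θ) {ρ : Fin 3 → S3} (h : θ ⨯₃ ρ = 0) :
    ∃ μ : S3, ρ = μ • θ := D.primitive_theta.exists_eq_smul h

lemma exists_cofactor (D : IsEigenData f d r θ) {ρ : Fin 3 → S3} (hρ : ρ ∈ jacSyz f) :
    ∃ c : S3, θ ⨯₃ ρ = c • jacGrad f := by
  refine D.grad.exists_eq_smul ?_
  have h1 := mem_jacSyz_iff.mp D.syz
  have h2 := mem_jacSyz_iff.mp hρ
  ext1 i
  simp only [cross_apply, jacGrad]
  fin_cases i <;> simp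
  · linear_combination θ 0 * h2 - ρ 0 * h1
  · linear_combination θ 1 * h2 - ρ 1 * h1
  · linear_combination θ 2 * h2 - ρ 2 * h1

lemma mem_jacSyz {c : S3} {ρ : Fin 3 → S3} (hc : c ≠ 0)
    (h : θ ⨯₃ ρ = c • jacGrad f) : ρ ∈ jacSyz f := by
  rw [mem_jacSyz_iff]
  have h0 := congrFun h 0
  have h1 := congrFun h 1
  have h2 := congrFun h 2
  simp [cross_apply, jacGrad] at h0 h1 h2
  refine mul_left_cancel₀ hc ?_
  linear_combination -ρ 0 * h0 - ρ 1 * h1 - ρ 2 * h2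

lemma mem_eigenIdeal_iff {y : S3} : y ∈ eigenIdeal (θ 0) (θ 1) (θ 2) ↔
    ∃ ρ : Fin 3 → S3, y = ρ 0 * (X 1 * θ 2 - X 2 * θ 1) + ρ 1 * (X 2 * θ 0 - X 0 * θ 2) +
      ρ 2 * (X 0 * θ 1 - X 1 * θ 0) := by
  rw [eigenIdeal, Ideal.span, Submodule.mem_span_triple]
  constructor
  · rintro ⟨p, q, s, h⟩
    exact ⟨![p, q, s], by simpa using h.symm⟩
  · rintro ⟨ρ, h⟩
    exact ⟨ρ 0, ρ 1, ρ 2, by simpa using h.symm⟩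

lemma mem_eigenQuotient_iff (D : IsEigenData f d r θ) {c : S3} :
    c ∈ eigenQuotient f θ ↔ ∃ ρ : Fin 3 → S3, θ ⨯₃ ρ = c • jacGrad f := by
  have hd : (d : ℂ) ≠ 0 := by
    have := D.two_mul_lt
    exact_mod_cast (by omega : d ≠ 0)
  have hE := jacGrad_euler D.hom
  rw [eigenQuotient, Ideal.mem_colon_span_singleton, mem_eigenIdeal_iff]
  constructor
  · rintro ⟨ρ, hρ⟩
    set w : Fin 3 → S3 := c • jacGrad f - θ ⨯₃ ((C (d : ℂ) : S3) • ρ) with hw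
    have hθ := mem_jacSyz_iff.mp D.syz
    obtain ⟨μ, hμ⟩ : ∃ μ : S3, w = μ • ((X : Fin 3 → S3) ⨯₃ θ) := by
      refine D.eigen.exists_eq_smul ?_
      ext1 i
      simp only [hw, cross_apply]
      fin_cases i <;> simp [jacGrad, -map_natCast]
      · linear_combination θ 0 * c * hE + θ 0 * C (d : ℂ) * hρ - X 0 * c * hθ
      · linear_combination θ 1 * c * hE + θ 1 * C (d : ℂ) * hρ - X 1 * c * hθ
      · linear_combination θ 2 * c * hE + θ 2 * C (d : ℂ) * hρ - X 2 * c * hθ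
    refine ⟨(C (d : ℂ) : S3) • ρ - μ • (X : Fin 3 → S3), ?_⟩
    rw [map_sub, map_smul _ μ, ← cross_anticomm (X : Fin 3 → S3) θ, smul_neg, ← hμ, hw]
    abel
  · rintro ⟨ρ, hρ⟩
    refine ⟨(C (d : ℂ)⁻¹ : S3) • ρ, ?_⟩
    have h0 := congrFun hρ 0
    have h1 := congrFun hρ 1
    have h2 := congrFun hρ 2
    simp [cross_apply, jacGrad] at h0 h1 h2
    have hC : (C (d : ℂ)⁻¹ : S3) * C (d : ℂ) = 1 := by rw [← C_mul, inv_mul_cancel₀ hd, C_1]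
    simp only [Pi.smul_apply, smul_eq_mul]
    linear_combination (-c * f) * hC - C (d : ℂ)⁻¹ * c * hE -
      C (d : ℂ)⁻¹ * (X 0 * h0 + X 1 * h1 + X 2 * h2)

lemma component_cross (D : IsEigenData f d r θ) {c : S3} {ρ : Fin 3 → S3}
    (h : θ ⨯₃ ρ = c • jacGrad f) (n : ℕ) :
    θ ⨯₃ vecComponent (n + (d - 1 - r)) ρ = homogeneousComponent n c • jacGrad f := by
  have hd := D.two_mul_lt
  have hl (i j) : homogeneousComponent (n + (d - 1)) (θ i * ρ j) =
      θ i * homogeneousComponent (n + (d - 1 - r)) (ρ j) := by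
    rw [mul_comm, homogeneousComponent_mul_of_le (D.hom_theta i) (by omega), mul_comm]
    congr 3
    omega
  have hg (i) : homogeneousComponent (n + (d - 1)) (c * pderiv i f) =
      homogeneousComponent n c * pderiv i f := by
    rw [homogeneousComponent_mul_of_le D.hom.pderiv (by omega), Nat.add_sub_cancel]
  have h0 := congr(homogeneousComponent (n + (d - 1)) $(congrFun h 0))
  have h1 := congr(homogeneousComponent (n + (d - 1)) $(congrFun h 1))
  have h2 := congr(homogeneousComponent (n + (d - 1)) $(congrFun h 2))
  simp only [cross_apply, jacGrad, Pi.smul_apply, smul_eq_mul, Matrix.cons_val, map_sub, hl, hg]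
    at h0 h1 h2
  ext1 i
  simp only [cross_apply, vecComponent]
  fin_cases i
  · simpa [jacGrad] using h0
  · simpa [jacGrad] using h1
  · simpa [jacGrad] using h2

lemma homogeneousComponent_mem (D : IsEigenData f d r θ) {c : S3} (hc : c ∈ eigenQuotient f θ)
    (n : ℕ) : homogeneousComponent n c ∈ eigenQuotient f θ := by
  obtain ⟨ρ, hρ⟩ := D.mem_eigenQuotient_iff.mp hc
  exact D.mem_eigenQuotient_iff.mpr ⟨_, D.component_cross hρ n⟩

lemma exists_lift (D : IsEigenData f d r θ) {c : S3} (hc : c ∈ eigenQuotient f θ) (hc0 : c ≠ 0)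
    {n : ℕ} (hn : c.IsHomogeneous n) : ∃ ρ ∈ jacSyz f,
      (∀ i, (ρ i).IsHomogeneous (n + (d - 1 - r))) ∧ θ ⨯₃ ρ = c • jacGrad f := by
  obtain ⟨ρ, hρ⟩ := D.mem_eigenQuotient_iff.mp hc
  have h := D.component_cross hρ n
  rw [homogeneousComponent_eq_self hn] at h
  exact ⟨_, mem_jacSyz hc0 h, fun i => homogeneousComponent_isHomogeneous _ _, h⟩

lemma isHomogeneous_cross (D : IsEigenData f d r θ) {ρ : Fin 3 → S3} {m : ℕ}
    (hρ : ∀ i, (ρ i).IsHomogeneous m) (i : Fin 3) : ((θ ⨯₃ ρ) i).IsHomogeneous (r + m) := by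
  rw [cross_apply]
  fin_cases i <;> exact ((D.hom_theta _).mul (hρ _)).sub ((D.hom_theta _).mul (hρ _))

lemma isHomogeneous_cofactor (D : IsEigenData f d r θ) {ρ : Fin 3 → S3} {m n : ℕ} {c : S3}
    (hρ : ∀ i, (ρ i).IsHomogeneous m) (h : θ ⨯₃ ρ = c • jacGrad f)
    (hm : m = n + (d - 1 - r)) : c.IsHomogeneous n := by
  have hd := D.two_mul_lt
  obtain ⟨i, hi⟩ := Function.ne_iff.mp D.grad.ne_zero
  refine IsHomogeneous.of_mul_right (q := pderiv i f) D.hom.pderiv hi ?_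
  have := D.isHomogeneous_cross hρ i
  rw [h] at this
  rwa [show n + (d - 1) = r + m by omega]

lemma eq_zero_of_lt (D : IsEigenData f d r θ) {v : Fin 3 → S3} (hv : v ∈ jacSyz f) {m : ℕ}
    (hm : m < r) (hom : ∀ i, (v i).IsHomogeneous m) : v = 0 := by
  have hd := D.two_mul_lt
  obtain ⟨c, hc⟩ := D.exists_cofactor hv
  obtain ⟨i, hi⟩ := Function.ne_iff.mp D.grad.ne_zero
  have hc0 : c = 0 := by
    by_contra hc0
    have h1 := D.isHomogeneous_cross hom i
    rw [hc] at h1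
    have := IsHomogeneous.le_of_mul (q := pderiv i f) D.hom.pderiv (mul_ne_zero hc0 hi) h1
    omega
  obtain ⟨μ, rfl⟩ := D.exists_eq_smul (by rw [hc, hc0, zero_smul])
  rw [← vecComponent_eq_self hom, vecComponent_smul_of_lt D.hom_theta hm]

lemma isMDR (D : IsEigenData f d r θ) : IsMDR f r :=
  ⟨⟨θ, D.syz, D.primitive_theta.ne_zero, D.hom_theta⟩,
    fun _ hm _ hv hom => D.eq_zero_of_lt hv hm hom⟩

/-- Saturation of `I_θ : (f)`: membership may be tested after multiplication by `ℓ` and by two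
elements relatively prime modulo `ℓ`. -/
lemma mem_of_mul_mem (D : IsEigenData f d r θ) {τ : Type*} {ι : τ → Fin 3} {ℓ : S3}
    {π : S3 →ₐ[ℂ] MvPolynomial τ ℂ} (hℓ0 : ℓ ≠ 0) (hsec : ∀ y, π (rename ι y) = y)
    (hker : ∀ x, π x = 0 ↔ ℓ ∣ x) {g p q : S3} (hpq : IsRelPrime (π p) (π q)) (hp : π p ≠ 0)
    (hgℓ : g * ℓ ∈ eigenQuotient f θ) (hgp : g * p ∈ eigenQuotient f θ)
    (hgq : g * q ∈ eigenQuotient f θ) : g ∈ eigenQuotient f θ := by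
  obtain ⟨u, hu⟩ := D.mem_eigenQuotient_iff.mp hgℓ
  obtain ⟨v, hv⟩ := D.mem_eigenQuotient_iff.mp hgp
  obtain ⟨w, hw⟩ := D.mem_eigenQuotient_iff.mp hgq
  obtain ⟨α, hα⟩ : ∃ α : S3, p • u - ℓ • v = α • θ := D.exists_eq_smul (by
    rw [map_sub, map_smul, map_smul, hu, hv]; module)
  obtain ⟨β, hβ⟩ : ∃ β : S3, q • v - p • w = β • θ := D.exists_eq_smul (by
    rw [map_sub, map_smul, map_smul, hv, hw]; module)
  obtain ⟨γ, hγ⟩ : ∃ γ : S3, ℓ • w - q • u = γ • θ := D.exists_eq_smul (by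
    rw [map_sub, map_smul, map_smul, hw, hu]; module)
  have hrel : q * α + ℓ * β + p * γ = 0 := by
    have h : (q * α + ℓ * β + p * γ) • θ = 0 := by
      rw [add_smul, add_smul, mul_smul, mul_smul, mul_smul, ← hα, ← hβ, ← hγ]
      module
    exact (smul_eq_zero.mp h).resolve_right D.primitive_theta.ne_zero
  have hπℓ : π ℓ = 0 := (hker ℓ).mpr dvd_rfl
  obtain ⟨x, hx⟩ : π p ∣ π α := by
    refine hpq.dvd_of_dvd_mul_left ⟨-π γ, ?_⟩
    have := congr(π $hrel)
    simp only [map_add, map_mul, hπℓ, map_zero] at this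
    linear_combination this
  obtain ⟨B, hB⟩ : ℓ ∣ α - p * rename ι x := by
    rw [← hker, map_sub, map_mul, hsec, hx, sub_self]
  have hdiv (i) : ℓ ∣ (u - rename ι x • θ) i := by
    rw [← hker]
    have h : p * (u - rename ι x • θ) i = ℓ * (v i + B * θ i) := by
      have := congrFun hα i
      simp only [Pi.sub_apply, Pi.smul_apply, smul_eq_mul] at this ⊢
      linear_combination this + θ i * hB
    have := congr(π $h)
    rw [map_mul, map_mul, hπℓ, zero_mul] at this
    exact (mul_eq_zero.mp this).resolve_left hp
  choose s hs using hdiv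
  refine D.mem_eigenQuotient_iff.mpr ⟨s, ?_⟩
  have hus : u - rename ι x • θ = ℓ • s := funext hs
  have h : ℓ • (θ ⨯₃ s) = ℓ • (g • jacGrad f) := by
    rw [← map_smul, ← hus, map_sub, map_smul, cross_self, smul_zero, sub_zero, hu, mul_comm,
      mul_smul]
  exact smul_right_injective _ hℓ0 h

/-- A proper quotient `I_θ : (f)` containing a linear form is generated by that form and one more
homogeneous element. -/
lemma exists_eq_span_pair (D : IsEigenData f d r θ) (htop : eigenQuotient f θ ≠ ⊤) {ℓ : S3}
    (hℓ : ℓ ∈ eigenQuotient f θ) (hℓ0 : ℓ ≠ 0) (hℓ1 : ℓ.IsHomogeneous 1) :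
    ∃ (h : S3) (e : ℕ), 1 ≤ e ∧ h.IsHomogeneous e ∧ eigenQuotient f θ = Ideal.span {ℓ, h} ∧
      ¬ ℓ ∣ h ∧ ¬ h ∣ ℓ := by
  obtain ⟨i, π, hsec, hker⟩ := exists_retraction_of_isHomogeneous_one hℓ1 hℓ0
  have hπℓ : π ℓ = 0 := (hker ℓ).mpr dvd_rfl
  have hsurj : Function.Surjective π := fun y => ⟨_, hsec y⟩
  have hlift {y} : y ∈ (eigenQuotient f θ).map π ↔ rename Subtype.val y ∈ eigenQuotient f θ := by
    constructor
    · intro hy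
      obtain ⟨x, hx, rfl⟩ := (Ideal.mem_map_iff_of_surjective _ hsurj).mp hy
      have : ℓ ∣ x - rename Subtype.val (π x) := by rw [← hker, map_sub, hsec, sub_self]
      exact (Submodule.sub_mem_iff_right _ hx).mp (Ideal.mem_of_dvd _ this hℓ)
    · intro hy
      rw [← hsec y]
      exact Ideal.mem_map_of_mem _ hy
  have hbot : (eigenQuotient f θ).map π ≠ ⊥ := by
    intro hbot
    have : IsUnit ℓ := D.eigen ℓ fun j => by
      rw [← hker, ← Ideal.mem_bot, ← hbot]
      refine Ideal.mem_map_of_mem _ ?_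
      have hle : eigenIdeal (θ 0) (θ 1) (θ 2) ≤ eigenQuotient f θ := Ideal.le_colon
      apply hle
      rw [X_cross_apply]
      refine Ideal.subset_span ?_
      fin_cases j <;> simp
    exact htop (Ideal.eq_top_of_isUnit_mem _ hℓ this)
  obtain ⟨k, hk0, hk⟩ := Ideal.exists_eq_span_singleton_of_isRelPrime hbot
    fun g p q hpq hp hgp hgq => by
      rw [hlift] at hgp hgq ⊢
      rw [map_mul] at hgp hgq
      exact D.mem_of_mul_mem hℓ0 hsec hker (by rwa [hsec, hsec]) (by rwa [hsec])
        (Ideal.mul_mem_left _ _ hℓ) hgp hgq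
  have hkmem : rename Subtype.val k ∈ eigenQuotient f θ := by
    rw [← hlift, hk]
    exact Ideal.mem_span_singleton_self k
  have hkhom : k.IsHomogeneous k.totalDegree := by
    obtain ⟨n, hn⟩ : ∃ n, homogeneousComponent n k ≠ 0 := by
      by_contra! h
      exact hk0 (by rw [← sum_homogeneousComponent k]; simp [h])
    have hcomp : k ∣ homogeneousComponent n k := by
      rw [← Ideal.mem_span_singleton, ← hk, hlift, rename_homogeneousComponent]
      exact D.homogeneousComponent_mem hkmem _
    obtain ⟨m, hm⟩ := (homogeneousComponent_isHomogeneous n k).exists_of_dvd hn hcomp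
    rwa [hm.totalDegree hk0]
  have hunit : ¬ IsUnit (rename Subtype.val k : S3) :=
    fun hu => htop (Ideal.eq_top_of_isUnit_mem _ hkmem hu)
  have hh0 : (rename Subtype.val k : S3) ≠ 0 := by
    intro h0
    exact hk0 (by rw [← hsec k, h0, map_zero])
  have hhom : (rename Subtype.val k : S3).IsHomogeneous k.totalDegree :=
    hkhom.rename_isHomogeneous
  refine ⟨rename Subtype.val k, k.totalDegree,
    Nat.one_le_iff_ne_zero.mpr (hhom.ne_zero_of_not_isUnit hh0 hunit), hhom,
    le_antisymm (fun x hx => ?_) ?_, ?_, ?_⟩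
  · have hx' := Ideal.mem_map_of_mem π hx
    rw [hk, Ideal.mem_span_singleton] at hx'
    obtain ⟨y, hy⟩ := hx'
    obtain ⟨z, hz⟩ : ℓ ∣ x - rename Subtype.val k * rename Subtype.val y := by
      rw [← hker, map_sub, map_mul, hsec, hsec, hy, sub_self]
    exact Ideal.mem_span_pair.mpr ⟨z, rename Subtype.val y, by linear_combination -hz⟩
  · rw [Ideal.span_le]
    rintro x (rfl | rfl)
    · exact hℓ
    · exact hkmem
  · rw [← hker, hsec]
    exact hk0
  · rintro ⟨y, hy⟩
    have h := congr(π $hy)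
    rw [hπℓ, map_mul, hsec] at h
    obtain ⟨z, rfl⟩ := (hker y).mp ((mul_eq_zero.mp h.symm).resolve_left hk0)
    refine hunit (IsUnit.of_mul_eq_one z (mul_left_cancel₀ hℓ0 ?_))
    linear_combination -hy

lemma image_ne_fin_three {α : Type*} (v : Fin 3 → α) :
    v '' {j | j ≠ 0} = {v 1, v 2} ∧ v '' {j | j ≠ 1} = {v 0, v 2} ∧
      v '' {j | j ≠ 2} = {v 0, v 1} := by
  refine ⟨?_, ?_, ?_⟩ <;> ext x <;> simp [Fin.exists_fin_succ, eq_comm]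

lemma exists_isMinGenSyz (D : IsEigenData f d r θ) {ℓ h : S3} {e : ℕ} (he : 1 ≤ e)
    (hℓ1 : ℓ.IsHomogeneous 1) (hh : h.IsHomogeneous e)
    (hK : eigenQuotient f θ = Ideal.span {ℓ, h}) (hℓh : ¬ ℓ ∣ h) (hhℓ : ¬ h ∣ ℓ) :
    ∃ v, IsMinGenSyz f 3 ![r, d - r, d - r - 1 + e] v := by
  have hd := D.two_mul_lt
  have hℓ0 : ℓ ≠ 0 := by rintro rfl; exact hhℓ (dvd_zero h)
  have hh0 : h ≠ 0 := by rintro rfl; exact hℓh (dvd_zero ℓ)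
  obtain ⟨u, hu, huhom, hux⟩ := D.exists_lift (c := ℓ)
    (by rw [hK]; exact Ideal.subset_span (by simp)) hℓ0 hℓ1
  obtain ⟨w, hw, hwhom, hwx⟩ := D.exists_lift (c := h)
    (by rw [hK]; exact Ideal.subset_span (by simp)) hh0 hh
  rw [show 1 + (d - 1 - r) = d - r by omega] at huhom
  rw [show e + (d - 1 - r) = d - r - 1 + e by omega] at hwhom
  have hmem : ∀ j, (![θ, u, w] : Fin 3 → Fin 3 → S3) j ∈ jacSyz f := by
    intro j
    fin_cases j
    exacts [D.syz, hu, hw]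
  have hgrad := D.grad.ne_zero
  obtain ⟨hi0, hi1, hi2⟩ := image_ne_fin_three (![θ, u, w] : Fin 3 → Fin 3 → S3)
  have hmin0 : θ ∉ Submodule.span S3 {u, w} := by
    rw [Submodule.mem_span_pair]
    rintro ⟨p, q, hpq⟩
    have := congr(vecComponent r $hpq)
    rw [vecComponent_add, vecComponent_smul_of_lt huhom (by omega),
      vecComponent_smul_of_lt hwhom (by omega), vecComponent_eq_self D.hom_theta, add_zero] at this
    exact D.primitive_theta.ne_zero this.symm
  have hmin1 : u ∉ Submodule.span S3 {θ, w} := by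
    rw [Submodule.mem_span_pair]
    rintro ⟨p, q, hpq⟩
    have := congr(θ ⨯₃ $hpq)
    rw [map_add, map_smul, map_smul, cross_self, smul_zero, zero_add, hwx, hux, smul_smul] at this
    exact hhℓ ⟨q, by rw [mul_comm]; exact (smul_left_injective S3 hgrad this).symm⟩
  have hmin2 : w ∉ Submodule.span S3 {θ, u} := by
    rw [Submodule.mem_span_pair]
    rintro ⟨p, q, hpq⟩
    have := congr(θ ⨯₃ $hpq)
    rw [map_add, map_smul, map_smul, cross_self, smul_zero, zero_add, hwx, hux, smul_smul] at this
    exact hℓh ⟨q, by rw [mul_comm]; exact (smul_left_injective S3 hgrad this).symm⟩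
  refine ⟨![θ, u, w], hmem, ?_, ?_, le_antisymm ?_ ?_, ?_, ?_⟩
  · intro j
    fin_cases j
    exacts [D.hom_theta, huhom, hwhom]
  · intro j
    fin_cases j
    · exact D.primitive_theta.ne_zero
    · exact fun h0 => hmin1 (by rw [show u = 0 from h0]; exact Submodule.zero_mem _)
    · exact fun h0 => hmin2 (by rw [show w = 0 from h0]; exact Submodule.zero_mem _)
  · rw [Submodule.span_le]
    rintro _ ⟨j, rfl⟩
    exact hmem j
  · intro ρ hρ
    obtain ⟨c, hc⟩ := D.exists_cofactor hρ
    have hcK := D.mem_eigenQuotient_iff.mpr ⟨ρ, hc⟩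
    rw [hK, Ideal.mem_span_pair] at hcK
    obtain ⟨p, q, rfl⟩ := hcK
    obtain ⟨μ, hμ⟩ : ∃ μ : S3, ρ - (p • u + q • w) = μ • θ := D.exists_eq_smul (by
      rw [map_sub, map_add, map_smul, map_smul, hc, hux, hwx]; module)
    rw [Submodule.mem_span_range_iff_exists_fun]
    refine ⟨![μ, p, q], ?_⟩
    rw [Fin.sum_univ_three]
    simp only [Matrix.cons_val]
    rw [← hμ]
    abel
  · intro j
    fin_cases j
    · exact hi0 ▸ hmin0
    · exact hi1 ▸ hmin1
    · exact hi2 ▸ hmin2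
  · rw [Fin.monotone_iff_le_succ]
    intro j
    fin_cases j <;> simp <;> omega

/-- Exponents of a plus-one generated curve, read off the quotient `I_θ : (f)`. -/
lemma of_isPOGWith (D : IsEigenData f d r θ) {d₁ d₂ d₃ : ℕ} (hsum : d₁ + d₂ = d)
    {v : Fin 3 → Fin 3 → S3} (hv : IsMinGenSyz f 3 ![d₁, d₂, d₃] v) :
    d₁ = r ∧ d₂ ≤ d₃ ∧ ∃ ℓ h : S3, ℓ ≠ 0 ∧ ℓ.IsHomogeneous 1 ∧
      h.IsHomogeneous (d₃ + 1 - d₂) ∧ eigenQuotient f θ = Ideal.span {ℓ, h} ∧ ¬ ℓ ∣ h := by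
  have hd := D.two_mul_lt
  have h12 : d₁ ≤ d₂ := hv.mono (show (0 : Fin 3) ≤ 1 by decide)
  have h23 : d₂ ≤ d₃ := hv.mono (show (1 : Fin 3) ≤ 2 by decide)
  have hom0 : ∀ i, (v 0 i).IsHomogeneous d₁ := hv.hom 0
  have hom1 : ∀ i, (v 1 i).IsHomogeneous d₂ := hv.hom 1
  have hom2 : ∀ i, (v 2 i).IsHomogeneous d₃ := hv.hom 2
  have hspan {ρ : Fin 3 → S3} (hρ : ρ ∈ jacSyz f) :
      ∃ c : Fin 3 → S3, c 0 • v 0 + c 1 • v 1 + c 2 • v 2 = ρ := by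
    rw [← hv.span_eq, Submodule.mem_span_range_iff_exists_fun] at hρ
    simpa only [Fin.sum_univ_three] using hρ
  have hr1 : r ≤ d₁ := by
    by_contra! hlt
    exact hv.ne_zero 0 (D.eq_zero_of_lt (hv.mem 0) hlt hom0)
  obtain ⟨c, hc⟩ := hspan D.syz
  have hcomp := congr(vecComponent r $hc)
  rw [vecComponent_add, vecComponent_add, vecComponent_eq_self D.hom_theta] at hcomp
  have h1r : d₁ = r := by
    by_contra hne
    rw [vecComponent_smul_of_lt hom0 (by omega), vecComponent_smul_of_lt hom1 (by omega),
      vecComponent_smul_of_lt hom2 (by omega)] at hcomp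
    exact D.primitive_theta.ne_zero (by rw [← hcomp]; simp)
  subst h1r
  rw [vecComponent_smul_self hom0, vecComponent_smul_of_lt hom1 (by omega),
      vecComponent_smul_of_lt hom2 (by omega), add_zero, add_zero] at hcomp
  set t := coeff 0 (c 0)
  have ht : t ≠ 0 := by
    intro ht
    rw [ht, C_0, zero_smul] at hcomp
    exact D.primitive_theta.ne_zero hcomp.symm
  have hv0 : v 0 = (C t⁻¹ : S3) • θ := by
    rw [← hcomp, smul_smul, ← C_mul, inv_mul_cancel₀ ht, C_1, one_smul]
  have hcross0 : θ ⨯₃ v 0 = 0 := by rw [hv0, map_smul, cross_self, smul_zero]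
  have hker {ρ : Fin 3 → S3} (h : θ ⨯₃ ρ = 0) : ∃ μ : S3, ρ = μ • v 0 := by
    obtain ⟨μ, rfl⟩ := D.exists_eq_smul h
    exact ⟨μ * C t, by rw [mul_smul, hcomp]⟩
  obtain ⟨ℓ, hℓ⟩ := D.exists_cofactor (hv.mem 1)
  obtain ⟨h, hh⟩ := D.exists_cofactor (hv.mem 2)
  obtain ⟨-, hi1, hi2⟩ := image_ne_fin_three v
  refine ⟨rfl, h23, ℓ, h, ?_, D.isHomogeneous_cofactor hom1 hℓ (by omega),
    D.isHomogeneous_cofactor hom2 hh (by omega), le_antisymm (fun x hx => ?_) ?_, ?_⟩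
  · rintro rfl
    obtain ⟨μ, hμ⟩ := hker (by rw [hℓ, zero_smul])
    refine hv.minimal 1 ?_
    rw [hi1, Submodule.mem_span_pair]
    exact ⟨μ, 0, by rw [hμ]; simp⟩
  · by_cases hx0 : x = 0
    · rw [hx0]
      exact Submodule.zero_mem _
    obtain ⟨ρ, hρ⟩ := D.mem_eigenQuotient_iff.mp hx
    obtain ⟨b, rfl⟩ := hspan (mem_jacSyz hx0 hρ)
    rw [map_add, map_add, map_smul, map_smul, map_smul, hcross0, hℓ, hh, smul_zero, zero_add,
      smul_smul, smul_smul, ← add_smul] at hρ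
    exact Ideal.mem_span_pair.mpr ⟨b 1, b 2, smul_left_injective S3 D.grad.ne_zero hρ⟩
  · rw [Ideal.span_le]
    rintro x (rfl | rfl)
    · exact D.mem_eigenQuotient_iff.mpr ⟨_, hℓ⟩
    · exact D.mem_eigenQuotient_iff.mpr ⟨_, hh⟩
  · rintro ⟨y, rfl⟩
    obtain ⟨μ, hμ⟩ := hker (ρ := v 2 - y • v 1) (by
      rw [map_sub, map_smul, hℓ, hh]; module)
    refine hv.minimal 2 ?_
    rw [hi2, Submodule.mem_span_pair]
    exact ⟨μ, y, by rw [← hμ]; abel⟩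

end IsEigenData

/-- An ideal generated by a linear form and a form of degree `e` not divisible by it determines
`e`. -/
lemma degree_le_of_span_pair_eq {ℓ h ℓ' h' : S3} {e e' : ℕ} (he : 1 ≤ e)
    (hℓ : ℓ.IsHomogeneous 1) (hh : h.IsHomogeneous e) (hℓ' : ℓ'.IsHomogeneous 1)
    (hh' : h'.IsHomogeneous e') (heq : Ideal.span {ℓ, h} = Ideal.span {ℓ', h'})
    (hndvd : ¬ ℓ' ∣ h') : e' ≤ e := by
  by_contra! hlt
  have key {x : S3} {n : ℕ} (hx : x ∈ Ideal.span {ℓ', h'}) (hxn : x.IsHomogeneous n)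
      (hn1 : 1 ≤ n) (hn : n < e') : ℓ' ∣ x := by
    obtain ⟨p, q, rfl⟩ := Ideal.mem_span_pair.mp hx
    rw [← homogeneousComponent_eq_self hxn, map_add, homogeneousComponent_mul_of_le hℓ' hn1,
      homogeneousComponent_mul_of_lt hh' hn, add_zero]
    exact dvd_mul_left _ _
  have h1 : ℓ' ∣ ℓ := key (heq ▸ Ideal.subset_span (by simp)) hℓ le_rfl (by omega)
  have h2 : ℓ' ∣ h := key (heq ▸ Ideal.subset_span (by simp)) hh he hlt
  have h3 : h' ∈ Ideal.span {ℓ, h} := heq ▸ Ideal.subset_span (by simp)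
  obtain ⟨p, q, rfl⟩ := Ideal.mem_span_pair.mp h3
  exact hndvd (dvd_add (Dvd.dvd.mul_left h1 _) (Dvd.dvd.mul_left h2 _))

lemma span_pair_ne_top {g h : S3} {m n : ℕ} (hm : 1 ≤ m) (hn : 1 ≤ n) (hg : g.IsHomogeneous m)
    (hh : h.IsHomogeneous n) : Ideal.span {g, h} ≠ ⊤ := by
  rw [Ideal.ne_top_iff_one, Ideal.mem_span_pair]
  rintro ⟨p, q, hpq⟩
  have := congr(homogeneousComponent 0 $hpq)
  rw [map_add, homogeneousComponent_mul_of_lt hg hm, homogeneousComponent_mul_of_lt hh hn,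
    homogeneousComponent_eq_self (isHomogeneous_one _ _), add_zero] at this
  exact zero_ne_one this

/-- Characterization of plus-one generated curves via eigenscheme ideals. Let `C : f = 0`
be a reduced plane curve of degree `d`, `θ = a ∂_x + b ∂_y + c ∂_z ∈ D_0(f)` a nonzero
derivation of degree `r` with `2r ≤ d - 1`, whose eigenscheme `Γ_θ` is 0-dimensional.
Then: (1) `r = mdr(f)`; (2) `C` is plus-one generated iff the ideal quotient
`K = I_θ : (f)` is proper with nonzero degree one component; and in that case `K` is
generated by a linear form `ℓ` and a homogeneous polynomial `h` of some degree `e ≥ 1`,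
the exponents of `C` are `(r, d - r, d - r - 1 + e)`, and `C` is nearly free iff `e = 1`,
and an MPOG-curve iff `e = 2`. -/
theorem statement15 (f : S3) (d r : ℕ) (hhom : f.IsHomogeneous d) (hred : Squarefree f)
    (a b c : S3) (hne : ¬ (a = 0 ∧ b = 0 ∧ c = 0))
    (ha : a.IsHomogeneous r) (hb : b.IsHomogeneous r) (hc : c.IsHomogeneous r)
    (hsyz : a * pderiv 0 f + b * pderiv 1 f + c * pderiv 2 f = 0)
    (hr : 2 * r + 1 ≤ d) (hΓ : EigenSchemeFinite a b c) :
    IsMDR f r ∧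
    (IsPOG f d ↔
      (Submodule.colon (eigenIdeal a b c) (Ideal.span {f}) ≠ ⊤ ∧
        ∃ ℓ ∈ Submodule.colon (eigenIdeal a b c) (Ideal.span {f}),
          ℓ ≠ 0 ∧ MvPolynomial.IsHomogeneous ℓ 1)) ∧
    ((Submodule.colon (eigenIdeal a b c) (Ideal.span {f}) ≠ ⊤ ∧
        ∃ ℓ ∈ Submodule.colon (eigenIdeal a b c) (Ideal.span {f}),
          ℓ ≠ 0 ∧ MvPolynomial.IsHomogeneous ℓ 1) →
      ∃ (ℓ h : S3) (e : ℕ), 1 ≤ e ∧ ℓ ≠ 0 ∧ MvPolynomial.IsHomogeneous ℓ 1 ∧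
        h ≠ 0 ∧ MvPolynomial.IsHomogeneous h e ∧
        Submodule.colon (eigenIdeal a b c) (Ideal.span {f}) = Ideal.span {ℓ, h} ∧
        (∃ v, IsMinGenSyz f 3 ![r, d - r, d - r - 1 + e] v) ∧
        (IsNearlyFree f d ↔ e = 1) ∧ (IsMPOG f d ↔ e = 2)) := by
  have hhomθ (i) : ((![a, b, c] : Fin 3 → S3) i).IsHomogeneous r := by
    fin_cases i
    exacts [ha, hb, hc]
  have D : IsEigenData f d r ![a, b, c] :=
    { hom := hhom
      hom_theta := hhomθ
      syz := hsyz
      two_mul_lt := hr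
      grad := isPrimitiveVec_jacGrad hhom (by omega) hred
      eigen := isPrimitiveVec_X_cross hhomθ hΓ }
  change _ ∧ (_ ↔ eigenQuotient f ![a, b, c] ≠ ⊤ ∧
    ∃ ℓ ∈ eigenQuotient f ![a, b, c], ℓ ≠ 0 ∧ ℓ.IsHomogeneous 1) ∧ (_ → _)
  refine ⟨D.isMDR, ⟨?_, ?_⟩, ?_⟩
  · rintro ⟨d₁, d₂, d₃, hsum, v, hv⟩
    obtain ⟨-, h23, ℓ, h, hℓ0, hℓ, hh, hK, -⟩ := D.of_isPOGWith hsum hv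
    rw [hK]
    exact ⟨span_pair_ne_top le_rfl (by omega) hℓ hh, ℓ, Ideal.subset_span (by simp), hℓ0, hℓ⟩
  · rintro ⟨htop, ℓ, hℓ, hℓ0, hℓ1⟩
    obtain ⟨h, e, he, hh, hK, hℓh, hhℓ⟩ := D.exists_eq_span_pair htop hℓ hℓ0 hℓ1
    exact ⟨r, d - r, d - r - 1 + e, by omega, D.exists_isMinGenSyz he hℓ1 hh hK hℓh hhℓ⟩
  · rintro ⟨htop, ℓ, hℓ, hℓ0, hℓ1⟩
    obtain ⟨h, e, he, hh, hK, hℓh, hhℓ⟩ := D.exists_eq_span_pair htop hℓ hℓ0 hℓ1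
    have hgen := D.exists_isMinGenSyz he hℓ1 hh hK hℓh hhℓ
    have hdeg {d₁ d₂ d₃ : ℕ} (hsum : d₁ + d₂ = d) {v} (hv : IsMinGenSyz f 3 ![d₁, d₂, d₃] v) :
        e = d₃ + 1 - d₂ := by
      obtain ⟨-, h23, ℓ', h', -, hℓ', hh', hK', hndvd⟩ := D.of_isPOGWith hsum hv
      have heq := hK.symm.trans hK'
      exact le_antisymm (degree_le_of_span_pair_eq (by omega) hℓ' hh' hℓ1 hh heq.symm hℓh)
        (degree_le_of_span_pair_eq he hℓ1 hh hℓ' hh' heq hndvd)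
    refine ⟨ℓ, h, e, he, hℓ0, hℓ1, ?_, hh, hK, hgen, ⟨?_, ?_⟩, ⟨?_, ?_⟩⟩
    · rintro rfl
      exact hℓh (dvd_zero ℓ)
    · rintro ⟨d₁, d₂, hsum, v, hv⟩
      have := hdeg hsum hv
      omega
    · rintro rfl
      rw [show d - r - 1 + 1 = d - r by omega] at hgen
      exact ⟨r, d - r, by omega, hgen⟩
    · rintro ⟨d₁, d₂, hsum, v, hv⟩
      have := hdeg hsum hv
      omega
    · rintro rfl
      rw [show d - r - 1 + 2 = d - r + 1 by omega] at hgen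
      exact ⟨r, d - r, by omega, hgen⟩

end
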